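/- For a (2,2)-quasimosaic (two rows, two columns), let b_1 and b_2 denote the bottom edges of the lower-left and lower-right tiles respectively, and let r_1 and r_2 denote the right edges of the upper-right and lower-right tiles respectively; mark an edge 'o' if it carries a connection point and 'x' otherwise (all other boundary edges are unconstrained). Then the numbers of (2,2)-quasimosaics with given pattern (b_1 b_2, r_1 r_2), arranged as a 4×4 matrix with rows indexed by b_1 b_2 and columns by r_1 r_2, both in the order xx, xo, ox, oo, are: row xx: 22, 22, 43, 43; row xo: 22, 55, 43, 139; row ox: 43, 43, 109, 64; row oo: 43, 139, 64, 403. -/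

import Mathlib

/-- The eleven mosaic tiles `T₀, …, T₁₀`. -/
inductive Tile : Type
  | T0 | T1 | T2 | T3 | T4 | T5 | T6 | T7 | T8 | T9 | T10
  deriving DecidableEq

namespace Tile

/-- Whether the top edge of a tile carries a connection point.
`T0` has no connection points; `T1,…,T6` realize the six unordered pairs of edges
(`T1`: bottom–left, `T2`: bottom–right, `T3`: top–right, `T4`: top–left,
`T5`: left–right, `T6`: top–bottom); `T7,…,T10` have all four. -/
def top : Tile → Bool
  | .T3 | .T4 | .T6 | .T7 | .T8 | .T9 | .T10 => true
  | _ => false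

/-- Whether the bottom edge of a tile carries a connection point. -/
def bottom : Tile → Bool
  | .T1 | .T2 | .T6 | .T7 | .T8 | .T9 | .T10 => true
  | _ => false

/-- Whether the left edge of a tile carries a connection point. -/
def left : Tile → Bool
  | .T1 | .T4 | .T5 | .T7 | .T8 | .T9 | .T10 => true
  | _ => false

/-- Whether the right edge of a tile carries a connection point. -/
def right : Tile → Bool
  | .T2 | .T3 | .T5 | .T7 | .T8 | .T9 | .T10 => true
  | _ => false

end Tile

/-- An `(m,n)`-mosaic `M : Fin m → Fin n → Tile` (rows indexed top-to-bottom,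
columns left-to-right) is suitably connected if any pair of contiguous tiles
have or do not have connection points simultaneously on their common edge. -/
def SuitablyConnected {m n : ℕ} (M : Fin m → Fin n → Tile) : Prop :=
  (∀ (i : Fin m) (j : Fin n) (h : (j : ℕ) + 1 < n),
    (M i j).right = (M i ⟨(j : ℕ) + 1, h⟩).left) ∧
  (∀ (i : Fin m) (j : Fin n) (h : (i : ℕ) + 1 < m),
    (M i j).bottom = (M ⟨(i : ℕ) + 1, h⟩ j).top)

/-- None of the boundary edges of the mosaic carries a connection point. -/
def BoundaryFree {m n : ℕ} (M : Fin m → Fin n → Tile) : Prop :=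
  ∀ (i : Fin m) (j : Fin n),
    ((i : ℕ) = 0 → (M i j).top = false) ∧
    ((i : ℕ) = m - 1 → (M i j).bottom = false) ∧
    ((j : ℕ) = 0 → (M i j).left = false) ∧
    ((j : ℕ) = n - 1 → (M i j).right = false)

/-- A knot `(m,n)`-mosaic is a suitably connected mosaic none of whose boundary
edges has a connection point. -/
def IsKnotMosaic {m n : ℕ} (M : Fin m → Fin n → Tile) : Prop :=
  SuitablyConnected M ∧ BoundaryFree M

/-- `D m n`, the number of knot `(m,n)`-mosaics. -/
noncomputable def knotMosaicCount (m n : ℕ) : ℕ :=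
  Nat.card {M : Fin m → Fin n → Tile // IsKnotMosaic M}

/-- `|Q^{(p,q)}|`, the number of `(p,q)`-quasimosaics (suitably connected
`(p,q)`-mosaics, with connection points allowed on boundary edges). -/
noncomputable def quasimosaicCount (p q : ℕ) : ℕ :=
  Nat.card {M : Fin p → Fin q → Tile // SuitablyConnected M}

/-- The number of `(2,2)`-quasimosaics whose bottom edges `b₁, b₂` (of the lower-left
and lower-right tiles) and right edges `r₁, r₂` (of the upper-right and lower-right
tiles) carry connection points exactly according to the given booleans
(`true` = 'o', `false` = 'x'). -/
noncomputable def quasi22Count (b₁ b₂ r₁ r₂ : Bool) : ℕ :=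
  Nat.card {M : Fin 2 → Fin 2 → Tile // SuitablyConnected M ∧
    (M 1 0).bottom = b₁ ∧ (M 1 1).bottom = b₂ ∧
    (M 0 1).right = r₁ ∧ (M 1 1).right = r₂}

instance : Fintype Tile where
  elems := {.T0, .T1, .T2, .T3, .T4, .T5, .T6, .T7, .T8, .T9, .T10}
  complete t := by cases t <;> decide

theorem suitablyConnected_two_two_iff (M : Fin 2 → Fin 2 → Tile) :
    SuitablyConnected M ↔
      ((M 0 0).right = (M 0 1).left ∧ (M 1 0).right = (M 1 1).left) ∧
      (M 0 0).bottom = (M 1 0).top ∧ (M 0 1).bottom = (M 1 1).top := by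
  constructor
  · rintro ⟨h, h'⟩
    exact ⟨⟨h 0 0 (by decide), h 1 0 (by decide)⟩, h' 0 0 (by decide), h' 0 1 (by decide)⟩
  · rintro ⟨⟨h₁, h₂⟩, h₃, h₄⟩
    refine ⟨fun i j h => ?_, fun i j h => ?_⟩ <;> fin_cases i <;> fin_cases j <;>
      first | assumption | exact absurd h (by decide)

/-- A `(2,2)`-quasimosaic with prescribed bottom and right boundary amounts to a marking
`(u, v, x, y)` of its four interior edges (upper, lower, left, right) together with four tiles
compatible with it. -/
def quasi22Equiv (b₁ b₂ r₁ r₂ : Bool) :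
    {M : Fin 2 → Fin 2 → Tile // SuitablyConnected M ∧
      (M 1 0).bottom = b₁ ∧ (M 1 1).bottom = b₂ ∧
      (M 0 1).right = r₁ ∧ (M 1 1).right = r₂} ≃
    Σ e : Bool × Bool × Bool × Bool,
      {t : Tile // t.right = e.1 ∧ t.bottom = e.2.2.1} ×
      {t : Tile // t.left = e.1 ∧ t.bottom = e.2.2.2 ∧ t.right = r₁} ×
      {t : Tile // t.right = e.2.1 ∧ t.top = e.2.2.1 ∧ t.bottom = b₁} ×
      {t : Tile // t.left = e.2.1 ∧ t.top = e.2.2.2 ∧ t.bottom = b₂ ∧ t.right = r₂} where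
  toFun M :=
    have h := (suitablyConnected_two_two_iff M.1).1 M.2.1
    ⟨((M.1 0 0).right, (M.1 1 0).right, (M.1 0 0).bottom, (M.1 0 1).bottom),
      ⟨M.1 0 0, rfl, rfl⟩, ⟨M.1 0 1, h.1.1.symm, rfl, M.2.2.2.2.1⟩,
      ⟨M.1 1 0, rfl, h.2.1.symm, M.2.2.1⟩,
      ⟨M.1 1 1, h.1.2.symm, h.2.2.symm, M.2.2.2.1, M.2.2.2.2.2⟩⟩
  invFun p :=
    ⟨![![p.2.1, p.2.2.1], ![p.2.2.2.1, p.2.2.2.2]], by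
      obtain ⟨e, ⟨a, ha⟩, ⟨b, hb⟩, ⟨c, hc⟩, ⟨d, hd⟩⟩ := p
      rw [suitablyConnected_two_two_iff]
      simp [ha, hb, hc, hd]⟩
  left_inv M := by
    ext i j
    fin_cases i <;> fin_cases j <;> rfl
  right_inv := by
    rintro ⟨⟨u, v, x, y⟩, ⟨a, ha⟩, ⟨b, hb⟩, ⟨c, hc⟩, ⟨d, hd⟩⟩
    dsimp only at ha hb hc hd
    obtain ⟨rfl, rfl⟩ := ha
    obtain ⟨-, rfl, -⟩ := id hb
    obtain ⟨rfl, -, -⟩ := id hc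
    rfl

theorem quasi22Count_eq_sum (b₁ b₂ r₁ r₂ : Bool) :
    quasi22Count b₁ b₂ r₁ r₂ = ∑ e : Bool × Bool × Bool × Bool,
      Fintype.card {t : Tile // t.right = e.1 ∧ t.bottom = e.2.2.1} *
      (Fintype.card {t : Tile // t.left = e.1 ∧ t.bottom = e.2.2.2 ∧ t.right = r₁} *
      (Fintype.card {t : Tile // t.right = e.2.1 ∧ t.top = e.2.2.1 ∧ t.bottom = b₁} *
      Fintype.card
        {t : Tile // t.left = e.2.1 ∧ t.top = e.2.2.2 ∧ t.bottom = b₂ ∧ t.right = r₂})) := by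
  rw [quasi22Count, Nat.card_congr (quasi22Equiv b₁ b₂ r₁ r₂), Nat.card_sigma]
  simp only [Nat.card_eq_fintype_card, Fintype.card_prod]

/-- The numbers of `(2,2)`-quasimosaics with given pattern `(b₁b₂, r₁r₂)`, arranged as
a `4 × 4` matrix with rows indexed by `b₁b₂` and columns by `r₁r₂`, both in the order
`xx, xo, ox, oo`:
row `xx`: `22, 22, 43, 43`; row `xo`: `22, 55, 43, 139`;
row `ox`: `43, 43, 109, 64`; row `oo`: `43, 139, 64, 403`. -/
theorem quasi22Count_values :
    (quasi22Count false false false false = 22 ∧ quasi22Count false false false true = 22 ∧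
     quasi22Count false false true false = 43 ∧ quasi22Count false false true true = 43) ∧
    (quasi22Count false true false false = 22 ∧ quasi22Count false true false true = 55 ∧
     quasi22Count false true true false = 43 ∧ quasi22Count false true true true = 139) ∧
    (quasi22Count true false false false = 43 ∧ quasi22Count true false false true = 43 ∧
     quasi22Count true false true false = 109 ∧ quasi22Count true false true true = 64) ∧
    (quasi22Count true true false false = 43 ∧ quasi22Count true true false true = 139 ∧
     quasi22Count true true true false = 64 ∧ quasi22Count true true true true = 403) := by
  simp only [quasi22Count_eq_sum]
  decide +kernel
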